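/- arXiv:1008.4966 — 3 statements merged into one kernel-verified Lean document; each statement's English description precedes it below -/
import Mathlib

section
/- (Inner-loop invariant in the proof of Theorem 1.) Let f be a flow, s ∈ S a source, and t₁ ∈ T a sink such that f admits no residual path from s to t₁. Let t₂ ∈ T be another sink and let f' be a flow that agrees with f on every ordered pair (u,v) except possibly on pairs (u,v) where both u and v lie on some fixed residual path (with respect to f) from s to t₂ (as happens when augmenting f along a residual s-to-t₂ path). Then f' also admits no residual path from s to t₁. -/
open Finset

variable {V : Type*}

/-- The excess (inflow minus outflow) of a vertex. -/
noncomputable def excess [Fintype V] (f : V → V → ℝ) (v : V) : ℝ :=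
  (∑ u, f u v) - (∑ w, f v w)

/-- Residual capacity of the arc `(u, v)`. -/
def Residual (c f : V → V → ℝ) (u v : V) : ℝ :=
  (c u v - f u v) + f v u

/-- Residual path: a chain of residual arcs. -/
def ResPath (c f : V → V → ℝ) : V → V → Prop :=
  Relation.ReflTransGen (fun a b => 0 < Residual c f a b)

/-- Capacity feasibility: `0 ≤ f ≤ c` on every arc. -/
def Feasible (c f : V → V → ℝ) : Prop :=
  ∀ u v, 0 ≤ f u v ∧ f u v ≤ c u v

/-- A preflow: capacity-feasible with nonnegative excess outside the sources. -/
def IsPreflow [Fintype V] (c f : V → V → ℝ) (S : Finset V) : Prop :=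
  Feasible c f ∧ ∀ v, v ∉ S → 0 ≤ excess f v

/-- A flow: capacity-feasible with zero excess outside sources and sinks. -/
def IsFlow [Fintype V] (c f : V → V → ℝ) (S T : Finset V) : Prop :=
  Feasible c f ∧ ∀ v, v ∉ S → v ∉ T → excess f v = 0

/-- The value of a (pre)flow: total excess at the sinks. -/
noncomputable def flowValue [Fintype V] (f : V → V → ℝ) (T : Finset V) : ℝ :=
  ∑ t ∈ T, excess f t

theorem mem_chain_reach {α : Type*} {r : α → α → Prop} (p : List α) :
    ∀ s : α, List.IsChain r p → p.head? = some s → ∀ v ∈ p, Relation.ReflTransGen r s v := by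
  induction p with
  | nil => intro s _ _ v hv; simp at hv
  | cons a l ih =>
    intro s hch hh v hv
    obtain rfl : a = s := by simpa using hh
    rcases List.mem_cons.1 hv with rfl | hv
    · exact Relation.ReflTransGen.refl
    · cases l with
      | nil => simp at hv
      | cons b l =>
        rw [List.isChain_cons_cons] at hch
        exact Relation.ReflTransGen.head hch.1 (ih b hch.2 rfl v hv)

/-- Inner-loop invariant of Theorem 1: augmenting along a residual path from s
to a sink t₂ (changing the flow only on pairs of vertices lying on that path)
cannot create a residual path from s to an already-saturated sink t₁. -/
theorem inner_loop_invariant [Fintype V]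
    (c : V → V → ℝ) (hc : ∀ u v, 0 ≤ c u v)
    (S T : Finset V) (hST : Disjoint S T)
    (f f' : V → V → ℝ) (hf : IsFlow c f S T) (hf' : IsFlow c f' S T)
    (s : V) (hs : s ∈ S)
    (t₁ : V) (ht₁ : t₁ ∈ T) (hnores : ¬ ResPath c f s t₁)
    (t₂ : V) (ht₂ : t₂ ∈ T) (p : List V)
    (hchain : List.Chain' (fun a b => 0 < Residual c f a b) p)
    (hhead : p.head? = some s) (hlast : p.getLast? = some t₂)
    (hagree : ∀ u v : V, f' u v ≠ f u v → u ∈ p ∧ v ∈ p) :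
    ¬ ResPath c f' s t₁ := by
  intro hres
  refine hnores ?_
  clear hnores
  have hp := mem_chain_reach p s hchain hhead
  unfold ResPath at hres ⊢
  clear ht₁
  induction hres with
  | refl => exact Relation.ReflTransGen.refl
  | @tail a b _ hab ih =>
    by_cases hb : b ∈ p
    · exact hp b hb
    · have h1 : f' a b = f a b := by
        by_contra h
        exact hb (hagree a b h).2
      have h2 : f' b a = f b a := by
        by_contra h
        exact hb (hagree b a h).1
      refine Relation.ReflTransGen.tail ?_ (?_ : 0 < Residual c f a b)
      · exact ih
      · simpa [Residual, h1, h2] using hab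
end

section
/- (Multi-source, multi-sink maximality characterization stated in Section 2.) A flow f is maximum, i.e., its value ∑_{t ∈ T} ex_f(t) is at least the value of every flow, if and only if there is no residual path (with respect to f) from any vertex of S to any vertex of T. -/
open Finset

variable {V : Type*}

open Classical in
/-- Adding `x` on the single arc `(a, b)`. -/
noncomputable def bump (f : V → V → ℝ) (a b : V) (x : ℝ) : V → V → ℝ :=
  fun u v => f u v + if u = a ∧ v = b then x else 0

open Classical in
theorem excess_bump [Fintype V] (f : V → V → ℝ) (a b : V) (x : ℝ) (v : V) :
    excess (bump f a b x) v
      = excess f v + x * ((if v = b then 1 else 0) - (if v = a then 1 else 0)) := by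
  have h1 : ∑ u, (if u = a ∧ v = b then x else 0) = if v = b then x else 0 := by
    by_cases h : v = b <;> simp [h]
  have h2 : ∑ w, (if v = a ∧ w = b then x else 0) = if v = a then x else 0 := by
    by_cases h : v = a <;> simp [h]
  simp only [excess, bump, Finset.sum_add_distrib, h1, h2]
  split_ifs <;> ring

open Classical in
theorem step_augment [Fintype V] (c f : V → V → ℝ) (hf : Feasible c f) (a b : V)
    (h : 0 < Residual c f a b) :
    ∃ g : V → V → ℝ, ∃ e : ℝ, 0 < e ∧ Feasible c g ∧ ∀ v, excess g v
      = excess f v + e * ((if v = b then 1 else 0) - (if v = a then 1 else 0)) := by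
  unfold Residual at h
  by_cases h1 : 0 < c a b - f a b
  · refine ⟨bump f a b (c a b - f a b), _, h1, ?_, excess_bump f a b _⟩
    intro u v
    have := hf u v
    unfold bump
    split_ifs with huv
    · obtain ⟨rfl, rfl⟩ := huv
      constructor <;> linarith
    · simpa using this
  · have h2 : 0 < f b a := by linarith
    refine ⟨bump f b a (-f b a), _, h2, ?_, ?_⟩
    · intro u v
      have := hf u v
      unfold bump
      split_ifs with huv
      · obtain ⟨rfl, rfl⟩ := huv
        constructor <;> linarith
      · simpa using this
    · intro v
      rw [excess_bump]
      ring

theorem excess_comb [Fintype V] (g h : V → V → ℝ) (p q : ℝ) (v : V) :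
    excess (fun u v => p * g u v + q * h u v) v = p * excess g v + q * excess h v := by
  simp only [excess, Finset.sum_add_distrib, ← Finset.mul_sum]
  ring

open Classical in
theorem path_augment [Fintype V] (c f : V → V → ℝ) (hf : Feasible c f) (s t : V)
    (h : ResPath c f s t) :
    ∃ g : V → V → ℝ, ∃ e : ℝ, 0 < e ∧ Feasible c g ∧ ∀ v, excess g v
      = excess f v + e * ((if v = t then 1 else 0) - (if v = s then 1 else 0)) := by
  unfold ResPath at h
  induction h with
  | refl => exact ⟨f, 1, one_pos, hf, fun v => by ring⟩
  | @tail a b _ hab ih =>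
    obtain ⟨g, e, he, hg, hge⟩ := ih
    obtain ⟨k, d, hd, hk, hke⟩ := step_augment c f hf a b hab
    have hs : 0 < e + d := by linarith
    have hpq : d / (e + d) + e / (e + d) = 1 := by field_simp; ring
    have hp : 0 < d / (e + d) := by positivity
    have hq : 0 < e / (e + d) := by positivity
    have hpe : d / (e + d) * e = e / (e + d) * d := by ring
    generalize d / (e + d) = p at *
    generalize e / (e + d) = q at *
    refine ⟨fun u v => p * g u v + q * k u v, q * d, by positivity, ?_, ?_⟩
    · intro u v
      obtain ⟨g0, g1⟩ := hg u v
      obtain ⟨k0, k1⟩ := hk u v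
      refine ⟨by positivity, ?_⟩
      have e1 := mul_le_mul_of_nonneg_left g1 hp.le
      have e2 := mul_le_mul_of_nonneg_left k1 hq.le
      have e3 : p * c u v + q * c u v = c u v := by rw [← add_mul, hpq, one_mul]
      show p * g u v + q * k u v ≤ c u v
      linarith
    · intro v
      rw [excess_comb, hge, hke]
      linear_combination (excess f v) * hpq
        + ((if v = a then 1 else 0) - (if v = s then 1 else 0)) * hpe

open Classical in
theorem sum_excess_cut [Fintype V] (g : V → V → ℝ) (R : Finset V) :
    ∑ v ∈ Rᶜ, excess g v = ∑ v ∈ Rᶜ, ∑ u ∈ R, (g u v - g v u) := by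
  have h0 : ∑ v ∈ Rᶜ, ∑ u ∈ Rᶜ, (g u v - g v u) = 0 := by
    simp only [Finset.sum_sub_distrib]
    rw [Finset.sum_comm, sub_self]
  have h1 : ∀ v, excess g v = ∑ u ∈ R, (g u v - g v u) + ∑ u ∈ Rᶜ, (g u v - g v u) := by
    intro v
    rw [Finset.sum_add_sum_compl, Finset.sum_sub_distrib, excess]
  simp only [h1, Finset.sum_add_distrib, h0, add_zero]

/-- Multi-source multi-sink maximality characterization: a flow is maximum iff
there is no residual path from any source to any sink. -/
theorem maxFlow_iff_no_residual_path [Fintype V]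
    (c : V → V → ℝ) (hc : ∀ u v, 0 ≤ c u v)
    (S T : Finset V) (hST : Disjoint S T)
    (f : V → V → ℝ) (hf : IsFlow c f S T) :
    (∀ g : V → V → ℝ, IsFlow c g S T → flowValue g T ≤ flowValue f T) ↔
    (∀ s ∈ S, ∀ t ∈ T, ¬ ResPath c f s t) := by
  classical
  constructor
  · intro hmax s hs t ht hp
    obtain ⟨g, e, he, hg, hge⟩ := path_augment c f hf.1 s t hp
    have hsT : s ∉ T := Finset.disjoint_left.mp hST hs
    have hfl : IsFlow c g S T := by
      refine ⟨hg, fun v hvS hvT => ?_⟩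
      have h1 : v ≠ t := fun h => hvT (h ▸ ht)
      have h2 : v ≠ s := fun h => hvS (h ▸ hs)
      rw [hge, hf.2 v hvS hvT]
      simp [h1, h2]
    have := hmax g hfl
    simp only [flowValue, hge, Finset.sum_add_distrib, ← Finset.mul_sum,
      Finset.sum_sub_distrib, Finset.sum_ite_eq', ht, hsT, if_true, if_false] at this
    linarith
  · intro hno g hg
    let R : Finset V := Finset.univ.filter (fun v => ∃ s ∈ S, ResPath c f s v)
    have hR : ∀ v, v ∈ R ↔ ∃ s ∈ S, ResPath c f s v := fun v => by simp [R]
    have hval : ∀ k, IsFlow c k S T → flowValue k T = ∑ v ∈ Rᶜ, excess k v := by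
      intro k hk
      apply Finset.sum_subset
      · intro t ht
        rw [Finset.mem_compl, hR]
        rintro ⟨s, hs, hp⟩
        exact hno s hs t ht hp
      · intro v hv hvT
        rw [Finset.mem_compl, hR] at hv
        exact hk.2 v (fun hvS => hv ⟨v, hvS, Relation.ReflTransGen.refl⟩) hvT
    rw [hval g hg, hval f hf, sum_excess_cut, sum_excess_cut]
    refine Finset.sum_le_sum fun v hv => Finset.sum_le_sum fun u hu => ?_
    rw [Finset.mem_compl, hR] at hv
    obtain ⟨s, hs, hp⟩ := (hR u).mp hu
    have hres : ¬ 0 < Residual c f u v := fun h => hv ⟨s, hs, Relation.ReflTransGen.tail hp h⟩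
    unfold Residual at hres
    have h1 := (hg.1 u v).2
    have h2 := (hg.1 v u).1
    linarith
end

section
/- (Counterexample to arbitrary pair orders, Figure 1.) There exists a finite vertex set V, a capacity function c : V → V → ℝ with c u v ≥ 0, two distinct sources s, s' and two distinct sinks t, t' (sources and sinks disjoint), and a sequence of flows f₀, f₁, f₂, f₃, f₄ with f₀ the zero flow, such that for each i ∈ {1,2,3,4}: f_i differs in excess from f_{i−1} only at the i-th source-sink pair in the order (s,t), (s',t'), (s,t'), (s',t), and f_i admits no residual path from the source to the sink of that pair (i.e., each step saturates a maximum flow for its pair in the residual graph); yet the value of f₄ is strictly less than the maximum {s,s'}-to-{t,t'} flow value. In particular, saturating an arbitrary order of source-sink pairs does not in general produce a maximum flow. -/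
open Finset

variable {V : Type*}

/-- One greedy saturation step for the pair (s, t): the excess changes only at
s (not increasing) and at t (not decreasing), and afterwards no residual
s-to-t path remains. -/
def SatStep [Fintype V] (c f f' : V → V → ℝ) (s t : V) : Prop :=
  (∀ v : V, v ≠ s → v ≠ t → excess f' v = excess f v) ∧
  excess f' s ≤ excess f s ∧
  excess f t ≤ excess f' t ∧
  ¬ ResPath c f' s t

/-- A set closed under residual arcs blocks every residual path leaving it. -/
lemma not_resPath_of_closed {V : Type*} (c f : V → V → ℝ) (X : V → Prop) {s t : V}
    (hs : X s) (ht : ¬ X t) (h : ∀ a b, X a → ¬ X b → Residual c f a b ≤ 0) :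
    ¬ ResPath c f s t := by
  intro hp
  apply ht
  clear ht
  unfold ResPath at hp
  induction hp with
  | refl => exact hs
  | tail _ hab ih =>
    by_contra hb
    exact absurd hab (not_lt.mpr (h _ _ ih hb))

/-- The six-vertex network. Sources are 0 and 1, sinks are 2 and 3, inner vertices are 4 and 5.
The values are x on the arc (0,4), y on (1,5), z on (4,5), p on (5,2), q on (4,3). -/
def netFlow (x y z p q : ℝ) : Fin 6 → Fin 6 → ℝ :=
  ![![0, 0, 0, 0, x, 0], ![0, 0, 0, 0, 0, y], ![0, 0, 0, 0, 0, 0],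
    ![0, 0, 0, 0, 0, 0], ![0, 0, 0, q, 0, z], ![0, 0, p, 0, 0, 0]]

lemma netFlow_isFlow (x y z p q : ℝ) (hx : 0 ≤ x ∧ x ≤ 2) (hy : 0 ≤ y ∧ y ≤ 1)
    (hz : 0 ≤ z ∧ z ≤ 1) (hp : 0 ≤ p ∧ p ≤ 2) (hq : 0 ≤ q ∧ q ≤ 1)
    (ha : x = z + q) (hb : y + z = p) :
    IsFlow (netFlow 2 1 1 2 1) (netFlow x y z p q) {0, 1} {2, 3} := by
  refine ⟨?_, ?_⟩
  · intro u v
    fin_cases u <;> fin_cases v <;> simp [netFlow] <;> assumption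
  · intro v h1 h2
    fin_cases v <;> simp [excess, netFlow, Fin.sum_univ_succ] at h1 h2 ⊢ <;> linarith

/-- Counterexample of Figure 1: saturating source-sink pairs in an arbitrary
order, here (s,t), (s',t'), (s,t'), (s',t), need not produce a maximum flow. -/
theorem greedy_pair_order_counterexample :
    ∃ (n : ℕ) (c : Fin n → Fin n → ℝ) (s s' t t' : Fin n)
      (f₀ f₁ f₂ f₃ f₄ : Fin n → Fin n → ℝ),
      (∀ u v, 0 ≤ c u v) ∧
      s ≠ s' ∧ t ≠ t' ∧
      Disjoint ({s, s'} : Finset (Fin n)) ({t, t'} : Finset (Fin n)) ∧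
      f₀ = (fun _ _ => 0) ∧
      IsFlow c f₀ {s, s'} {t, t'} ∧ IsFlow c f₁ {s, s'} {t, t'} ∧
      IsFlow c f₂ {s, s'} {t, t'} ∧ IsFlow c f₃ {s, s'} {t, t'} ∧
      IsFlow c f₄ {s, s'} {t, t'} ∧
      SatStep c f₀ f₁ s t ∧ SatStep c f₁ f₂ s' t' ∧
      SatStep c f₂ f₃ s t' ∧ SatStep c f₃ f₄ s' t ∧
      ∃ g : Fin n → Fin n → ℝ, IsFlow c g {s, s'} {t, t'} ∧
        flowValue f₄ {t, t'} < flowValue g {t, t'} := by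
  have h0 : (fun _ _ => 0 : Fin 6 → Fin 6 → ℝ) = netFlow 0 0 0 0 0 := by
    funext u v
    fin_cases u <;> fin_cases v <;> simp [netFlow]
  have hf2 : IsFlow (netFlow 2 1 1 2 1) (netFlow 1 1 0 1 1) {0, 1} {2, 3} := by
    apply netFlow_isFlow <;> norm_num
  refine ⟨6, netFlow 2 1 1 2 1, 0, 1, 2, 3, fun _ _ => 0, netFlow 1 0 1 1 0, netFlow 1 1 0 1 1,
    netFlow 1 1 0 1 1, netFlow 1 1 0 1 1, ?_, by decide, by decide, by decide, rfl, ?_, ?_,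
    hf2, hf2, hf2, ?_, ?_, ?_, ?_, netFlow 2 1 1 2 1, ?_, ?_⟩
  · intro u v
    fin_cases u <;> fin_cases v <;> simp [netFlow]
  · rw [h0]
    apply netFlow_isFlow <;> norm_num
  · apply netFlow_isFlow <;> norm_num
  · rw [h0]
    refine ⟨?_, ?_, ?_, ?_⟩
    · intro v h1 h2
      fin_cases v <;> simp [excess, netFlow, Fin.sum_univ_succ] at h1 h2 ⊢
    · simp [excess, netFlow, Fin.sum_univ_succ]
    · simp [excess, netFlow, Fin.sum_univ_succ]
    · apply not_resPath_of_closed _ _ (fun v => v = 0 ∨ v = 3 ∨ v = 4) (by decide) (by decide)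
      intro a b
      fin_cases a <;> fin_cases b <;> simp [Residual, netFlow]
  · refine ⟨?_, ?_, ?_, ?_⟩
    · intro v h1 h2
      fin_cases v <;> simp [excess, netFlow, Fin.sum_univ_succ] at h1 h2 ⊢
    · simp [excess, netFlow, Fin.sum_univ_succ]
    · simp [excess, netFlow, Fin.sum_univ_succ]
    · apply not_resPath_of_closed _ _ (fun v => v = 1) (by decide) (by decide)
      intro a b
      fin_cases a <;> fin_cases b <;> simp [Residual, netFlow]
  · refine ⟨fun _ _ _ => rfl, le_rfl, le_rfl, ?_⟩
    apply not_resPath_of_closed _ _ (fun v => v ≠ 3) (by decide) (by decide)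
    intro a b
    fin_cases a <;> fin_cases b <;> simp [Residual, netFlow]
  · refine ⟨fun _ _ _ => rfl, le_rfl, le_rfl, ?_⟩
    apply not_resPath_of_closed _ _ (fun v => v = 1) (by decide) (by decide)
    intro a b
    fin_cases a <;> fin_cases b <;> simp [Residual, netFlow]
  · apply netFlow_isFlow <;> norm_num
  · simp [flowValue, excess, netFlow, Fin.sum_univ_succ]
    try norm_num
end
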